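/- Let 𝔏' be the A-module (A/J₁)·u₁ ⊕ (A/J₁)·u₂ ⊕ (A/J₂)·u₃ ⊕ (A/J₃)·u₄, where J₁ := (e₁³, e₂², e₃², e₁e₂, e₁e₃, e₂e₃), J₂ := (e₁², e₂², e₁e₂, e₃) and J₃ := (e₁², e₂, e₃), and let 𝔎' ⊆ 𝔏' be the ℚ-subspace spanned by the three elements ρ₁ := 2e₂u₃ + 3e₁u₄, ρ₂ := e₂u₂ + 6e₁u₃ and ρ₃ := e₃u₂ − 6e₁²u₁ (each of which spans a trivial A-submodule of 𝔏'). Then the ℚ-vector space H_j(A; 𝔏'/𝔎') = Tor_j^A(ℚ, 𝔏'/𝔎') has dimension 4 for j = 0, dimension 15 for j = 1, dimension 17 for j = 2, dimension 6 for j = 3, and is zero for j ≥ 4. -/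

import Mathlib

open CategoryTheory MvPolynomial

noncomputable section

/-- `A = ℚ[e₁, e₂, e₃]`, the polynomial ring in three variables over `ℚ`;
the variable `eᵢ` is `X (i-1) : A` for `i = 1, 2, 3`. -/
abbrev A : Type := MvPolynomial (Fin 3) ℚ

/-- `ℚ` as an `A`-module via the augmentation sending each variable to `0`. -/
instance : Module A ℚ :=
  Module.compHom ℚ (MvPolynomial.aeval (fun _ : Fin 3 => (0 : ℚ))).toRingHom

/-- `H_j(A; M) = Tor_j^A(ℚ, M)`, as a `ℚ`-vector space (via restriction of scalars along
`ℚ → A`). -/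
def TorQ (j : ℕ) (M : ModuleCat A) : ModuleCat ℚ :=
  (ModuleCat.restrictScalars (algebraMap ℚ A)).obj
    (((Tor (ModuleCat A) j).obj (ModuleCat.of A ℚ)).obj M)

/-- `J₁ = (e₁³, e₂², e₃², e₁e₂, e₁e₃, e₂e₃)`. -/
def J₁ : Ideal A :=
  Ideal.span
    {(X 0 : A) ^ 3, (X 1 : A) ^ 2, (X 2 : A) ^ 2,
     (X 0 : A) * X 1, (X 0 : A) * X 2, (X 1 : A) * X 2}

/-- `J₂ = (e₁², e₂², e₁e₂, e₃)`. -/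
def J₂ : Ideal A :=
  Ideal.span {(X 0 : A) ^ 2, (X 1 : A) ^ 2, (X 0 : A) * X 1, (X 2 : A)}

/-- `J₃ = (e₁², e₂, e₃)`. -/
def J₃ : Ideal A := Ideal.span {(X 0 : A) ^ 2, (X 1 : A), (X 2 : A)}

/-- `𝔏' = (A/J₁)u₁ ⊕ (A/J₁)u₂ ⊕ (A/J₂)u₃ ⊕ (A/J₃)u₄`. -/
abbrev L' : Type := (A ⧸ J₁) × (A ⧸ J₁) × (A ⧸ J₂) × (A ⧸ J₃)

/-- `ρ₁ = 2e₂u₃ + 3e₁u₄`. -/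
def ρ₁ : L' :=
  (0, 0, Ideal.Quotient.mk J₂ (2 * X 1), Ideal.Quotient.mk J₃ (3 * X 0))

/-- `ρ₂ = e₂u₂ + 6e₁u₃`. -/
def ρ₂ : L' :=
  (0, Ideal.Quotient.mk J₁ (X 1), Ideal.Quotient.mk J₂ (6 * X 0), 0)

/-- `ρ₃ = e₃u₂ − 6e₁²u₁`. -/
def ρ₃ : L' :=
  (Ideal.Quotient.mk J₁ (-(6 : A) * X 0 ^ 2), Ideal.Quotient.mk J₁ (X 2), 0, 0)

/-- The submodule `𝔎'` generated by `ρ₁, ρ₂, ρ₃` (each of which spans a trivial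
`A`-submodule of `𝔏'`, so this is also the `ℚ`-span of `ρ₁, ρ₂, ρ₃`). -/
def K' : Submodule A L' := Submodule.span A {ρ₁, ρ₂, ρ₃}

/-- The `A`-module `𝔏'/𝔎'`. -/
def M19 : ModuleCat A := ModuleCat.of A (L' ⧸ K')

namespace S19

lemma span_aux (S : Set (Fin 3)) (k : Fin 3) (hk : k ∉ S) (m : A)
    (h : (X k : A) ^ 3 * m ∈ Ideal.span (X '' S : Set A)) :
    m ∈ Ideal.span (X '' S : Set A) := by
  rw [MvPolynomial.mem_ideal_span_X_image] at h ⊢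
  intro d hd
  have h1 : Finsupp.single k 3 + d ∈ ((X k : A) ^ 3 * m).support := by
    rw [mem_support_iff] at hd ⊢
    rw [X_pow_eq_monomial, coeff_monomial_mul, one_mul]
    exact hd
  obtain ⟨i, hi, hne⟩ := h _ h1
  refine ⟨i, hi, ?_⟩
  have : k ≠ i := by rintro rfl; exact hk hi
  simpa [Finsupp.single_apply, this] using hne

/-- The divisibility properties of the three variables that are used below. -/
structure Good {R : Type} [CommRing R] (x : Fin 3 → R) : Prop where
  inj : ∀ k a b, x k * a = x k * b → a = b
  dvd : ∀ k l, k ≠ l → ∀ a, x l ∣ x k ^ 3 * a → x l ∣ a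
  pair : ∀ a s t, x 0 ^ 3 * a = x 1 * s + x 2 * t → ∃ p q, a = x 1 * p + x 2 * q

lemma goodX : Good (fun k : Fin 3 => (X k : A)) where
  inj k a b h := mul_left_cancel₀ (X_ne_zero k) h
  dvd k l hkl a h := by
    have h1 := span_aux {l} k (by simpa using hkl) a (by
      rwa [Set.image_singleton, Ideal.mem_span_singleton])
    rwa [Set.image_singleton, Ideal.mem_span_singleton] at h1
  pair a s t h := by
    have h1 := span_aux {1, 2} 0 (by simp) a (by
      rw [h]
      exact Ideal.add_mem _ (Ideal.mul_mem_right _ _ (Ideal.subset_span (by simp)))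
        (Ideal.mul_mem_right _ _ (Ideal.subset_span (by simp))))
    rw [Set.image_pair, Ideal.mem_span_pair] at h1
    obtain ⟨p, q, h2⟩ := h1
    exact ⟨p, q, by rw [← h2, mul_comm p, mul_comm q]⟩

section Koszul
variable {R : Type} [CommRing R] {x : Fin 3 → R} (hx : Good x)

section
include hx

lemma dv1 {ι : Type} (k l : Fin 3) (hkl : k ≠ l) (m w : ι → R)
    (h : x k ^ 3 • m = x l • w) : ∃ m', m = x l • m' := by
  have : ∀ i, ∃ c, m i = x l * c := fun i =>
    hx.dvd k l hkl (m i) ⟨w i, congrFun h i⟩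
  choose c hc using this
  exact ⟨c, funext fun i => by simp [hc]⟩

lemma dv2 {ι : Type} (m s t : ι → R) (h : x 0 ^ 3 • m = x 1 • s + x 2 • t) :
    ∃ p q, m = x 1 • p + x 2 • q := by
  have : ∀ i, ∃ p q, m i = x 1 * p + x 2 * q := fun i =>
    hx.pair (m i) (s i) (t i) (congrFun h i)
  choose p q hc using this
  exact ⟨p, q, funext fun i => by simp [hc]⟩

lemma smulX_inj1 {ι : Type} (k : Fin 3) {v w : ι → R} (h : x k • v = x k • w) : v = w :=
  funext fun i => hx.inj k _ _ (congrFun h i)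

lemma smulX_inj {ι : Type} (k : Fin 3) (n : ℕ) {v w : ι → R}
    (h : x k ^ n • v = x k ^ n • w) : v = w := by
  induction n with
  | zero => simpa using h
  | succ n ih =>
    rw [pow_succ', mul_smul, mul_smul] at h
    exact ih (smulX_inj1 hx k h)
end

variable {ι : Type} (F G : Fin 3 → Module.End R (ι → R))
  (hGF : ∀ k n, G k (F k n) = x k ^ 3 • n)
  (hFF : ∀ k l n, F k (F l n) = F l (F k n))
  (hC : ∀ k l n, G k (F l n) = F l (G k n))

section
include hx hGF

lemma reg1 (k : Fin 3) {n m : ι → R} (h : F k n = F k m) : n = m :=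
  smulX_inj hx k 3 (by rw [← hGF, ← hGF, h])

lemma reg2a (l : Fin 3) (hl : 0 ≠ l) {n m : ι → R} (h : x l • n = F 0 m) :
    ∃ k, m = x l • k ∧ n = F 0 k := by
  have h1 : x 0 ^ 3 • m = x l • G 0 n := by
    rw [← hGF, ← h, map_smul]
  obtain ⟨k, rfl⟩ := dv1 hx 0 l hl _ _ h1
  refine ⟨k, rfl, smulX_inj1 hx l ?_⟩
  rw [h, map_smul]

lemma reg2p (l : Fin 3) (hl : 0 ≠ l) (r : ℕ) {n m : ι → R}
    (h : x l ^ r • n = F 0 m) : ∃ k, n = F 0 k := by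
  induction r generalizing n m with
  | zero => exact ⟨m, by simpa using h⟩
  | succ r ih =>
    rw [pow_succ', mul_smul] at h
    obtain ⟨k, -, hk⟩ := reg2a hx F G hGF l hl h
    exact ih hk

/-- modulo `e₃`, `e₂` is regular on the cokernel of `F 0`. -/
lemma reg3a {b a w : ι → R} (h : x 1 • b = F 0 a + x 2 • w) :
    ∃ c b', b = F 0 c + x 2 • b' := by
  have h1 : x 0 ^ 3 • a = x 1 • G 0 b + x 2 • G 0 (-w) := by
    rw [← hGF, ← map_smul, ← map_smul, h, map_add, map_smul, map_smul, map_neg]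
    module
  obtain ⟨p, q, rfl⟩ := dv2 hx _ _ _ h1
  have h2 : x 1 • (b - F 0 p) = x 2 • (w + F 0 q) := by
    rw [smul_sub, h, map_add, map_smul, map_smul]
    module
  obtain ⟨b', hb'⟩ := dv1 hx 1 2 (by decide) (b - F 0 p) (x 1 ^ 2 • (w + F 0 q)) (by
    rw [pow_succ, mul_smul, h2, smul_comm])
  exact ⟨p, b', by rw [← hb']; abel⟩

lemma reg3p (r : ℕ) {b a w : ι → R} (h : x 1 ^ r • b = F 0 a + x 2 • w) :
    ∃ c b', b = F 0 c + x 2 • b' := by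
  induction r generalizing b a w with
  | zero => exact ⟨a, w, by simpa using h⟩
  | succ r ih =>
    rw [pow_succ', mul_smul] at h
    obtain ⟨c, b', hb⟩ := reg3a hx F G hGF h
    exact ih hb
end

include hx hGF hFF hC

lemma reg2 {n m : ι → R} (h : F 1 n = F 0 m) : ∃ k, n = F 0 k := by
  apply reg2p hx F G hGF 1 (by decide) 3 (m := G 1 m)
  rw [← hGF, h, hC]

lemma reg3b {n a b : ι → R} (h : x 2 • n = F 0 a + F 1 b) :
    ∃ k l, n = F 0 k + F 1 l := by
  have h1 : x 1 ^ 3 • b = F 0 (-G 1 a) + x 2 • G 1 n := by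
    rw [← hGF, ← map_smul, h, map_add, hC, hC, map_neg]
    abel
  obtain ⟨c, b', rfl⟩ := reg3p hx F G hGF 3 h1
  have h2 : x 2 • (n - F 1 b') = F 0 (a + F 1 c) := by
    rw [smul_sub, h, map_add, map_add, map_smul, hFF 1 0]
    abel
  obtain ⟨k, -, hk⟩ := reg2a hx F G hGF 2 (by decide) h2
  exact ⟨k, b', by rw [← hk]; abel⟩

lemma reg3p' (r : ℕ) {n a b : ι → R} (h : x 2 ^ r • n = F 0 a + F 1 b) :
    ∃ k l, n = F 0 k + F 1 l := by
  induction r generalizing n a b with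
  | zero => exact ⟨a, b, by simpa using h⟩
  | succ r ih =>
    rw [pow_succ', mul_smul] at h
    obtain ⟨c, b', hb⟩ := reg3b hx F G hGF hFF hC h
    exact ih hb

lemma reg3 {n a b : ι → R} (h : F 2 n = F 0 a + F 1 b) :
    ∃ k l, n = F 0 k + F 1 l := by
  apply reg3p' hx F G hGF hFF hC 3 (a := G 2 a) (b := G 2 b)
  rw [← hGF, h, map_add, hC, hC]

lemma exact1 {a b c : ι → R} (h : F 0 a + F 1 b + F 2 c = 0) :
    ∃ x y z, a = F 1 z - F 2 y ∧ b = F 2 x - F 0 z ∧ c = F 0 y - F 1 x := by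
  obtain ⟨k, l, rfl⟩ := reg3 hx F G hGF hFF hC (n := c) (a := -a) (b := -b) (by
    rw [map_neg, map_neg, ← sub_eq_zero, ← h]; abel)
  obtain ⟨m, hm⟩ := reg2 hx F G hGF hFF hC (n := b + F 2 l) (m := -(a + F 2 k)) (by
    rw [map_neg, ← sub_eq_zero, ← h]
    simp only [map_add, hFF 2 0, hFF 2 1]; abel)
  have h3 : a + F 2 k + F 1 m = 0 := by
    apply reg1 hx F G hGF 0
    rw [map_zero, ← h]
    simp only [map_add, hFF 2 0, hFF 2 1]
    rw [hFF 0 1, ← hm, map_add]; abel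
  refine ⟨-l, k, -m, ?_, ?_, ?_⟩
  · rw [map_neg, ← sub_eq_zero, ← h3]; abel
  · rw [map_neg, map_neg, ← hm]; abel
  · rw [map_neg]; abel

lemma exact2 {a b c : ι → R} (h0 : F 1 c - F 2 b = 0) (h1 : F 2 a - F 0 c = 0)
    (h2 : F 0 b - F 1 a = 0) : ∃ k, a = F 0 k ∧ b = F 1 k ∧ c = F 2 k := by
  rw [sub_eq_zero] at h0 h1 h2
  obtain ⟨k, rfl⟩ := reg2 hx F G hGF hFF hC h2.symm
  refine ⟨k, rfl, reg1 hx F G hGF 0 ?_, reg1 hx F G hGF 0 ?_⟩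
  · rw [h2, hFF]
  · rw [← h1, hFF]

end Koszul

end S19

namespace S19

/-- Entries of the matrices of the three variables acting on `𝔏'/𝔎'`, in the basis
`u₁, e₁u₁, e₂u₁, e₃u₁, e₁²u₁, u₂, e₁u₂, e₁²u₂, u₃, e₁u₃, e₂u₃/3, u₄`. -/
def Xe : ℕ → ℕ → ℕ → ℤ
  | 0, 1, 0 => 1
  | 0, 4, 1 => 1
  | 0, 6, 5 => 1
  | 0, 7, 6 => 1
  | 0, 9, 8 => 1
  | 0, 10, 11 => -2
  | 1, 2, 0 => 1
  | 1, 9, 5 => -6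
  | 1, 10, 8 => 3
  | 2, 3, 0 => 1
  | 2, 4, 5 => 6
  | _, _, _ => 0

def Xz (k : Fin 3) : Matrix (Fin 12) (Fin 12) ℤ := fun i j => Xe k i j

lemma Xz_comm : ∀ k l, Xz k * Xz l = Xz l * Xz k := by decide +kernel
lemma Xz_nil : ∀ k, Xz k * Xz k * Xz k = 0 := by decide +kernel

section Mats
variable {R : Type} [CommRing R] (x : Fin 3 → R)

def FM (k : Fin 3) : Matrix (Fin 12) (Fin 12) R := x k • 1 - (Xz k).map (fun z => (z : R))

def D1 : Matrix (Fin 12) (Fin 3 × Fin 12) R := fun i q => FM x q.1 i q.2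
def D2 : Matrix (Fin 3 × Fin 12) (Fin 3 × Fin 12) R := fun p q =>
  if q.1 = p.1 + 2 then FM x (p.1 + 1) p.2 q.2
  else if q.1 = p.1 + 1 then - FM x (p.1 + 2) p.2 q.2 else 0
def D3 : Matrix (Fin 3 × Fin 12) (Fin 12) R := fun p j => FM x p.1 p.2 j

variable {S : Type} [CommRing S] (g : R →+* S)

lemma FM_map (k : Fin 3) (i j) : g (FM x k i j) = FM (fun k => g (x k)) k i j := by
  simp [FM, Matrix.one_apply, apply_ite g]

lemma D1_map : (D1 x).map g = D1 (fun k => g (x k)) := by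
  ext i j; simp [D1, FM_map]
lemma D2_map : (D2 x).map g = D2 (fun k => g (x k)) := by
  ext i j; simp [D2, FM_map, apply_ite g]
lemma D3_map : (D3 x).map g = D3 (fun k => g (x k)) := by
  ext i j; simp [D3, FM_map]
end Mats

/-! Rank computations -/

lemma rank_cert {m n : Type} [Fintype m] [Fintype n] [DecidableEq m] [DecidableEq n] {r : ℕ}
    (D : Matrix m n ℤ) (J : Fin r → n) (V : Matrix (Fin r) n ℤ) (L : Matrix (Fin r) m ℤ)
    (h1 : D.submatrix id J * V = (6 : ℤ) • D)
    (h2 : L * D.submatrix id J = (6 : ℤ) • (1 : Matrix (Fin r) (Fin r) ℤ)) :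
    (D.map (Int.castRingHom ℚ)).rank = r := by
  set Dq := D.map (Int.castRingHom ℚ)
  set U := Dq.submatrix id J
  have e1 : U * V.map (Int.castRingHom ℚ) = (6 : ℚ) • Dq := by
    have := congrArg (fun M => M.map (Int.castRingHom ℚ)) h1
    rw [Matrix.map_mul] at this
    rw [show U = (D.submatrix id J).map (Int.castRingHom ℚ) from rfl, this]
    ext i j; simp [Dq]
  have e2 : L.map (Int.castRingHom ℚ) * U = (6 : ℚ) • (1 : Matrix (Fin r) (Fin r) ℚ) := by
    have := congrArg (fun M => M.map (Int.castRingHom ℚ)) h2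
    rw [Matrix.map_mul] at this
    rw [show U = (D.submatrix id J).map (Int.castRingHom ℚ) from rfl, this]
    ext i j
    rw [Matrix.map_apply, Matrix.smul_apply, Matrix.smul_apply, Matrix.one_apply,
      Matrix.one_apply]
    split_ifs <;> simp
  apply le_antisymm
  · have : Dq = U * ((1 / 6 : ℚ) • V.map (Int.castRingHom ℚ)) := by
      rw [Matrix.mul_smul, e1, smul_smul]; norm_num
    rw [this]
    calc _ ≤ U.rank := Matrix.rank_mul_le_left _ _
      _ ≤ r := by simpa using Matrix.rank_le_card_width U
  · have hU : U = Dq * (1 : Matrix n n ℚ).submatrix id J := by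
      ext i j; simp [U, Matrix.mul_apply, Matrix.one_apply]
    have : (1 : Matrix (Fin r) (Fin r) ℚ) = ((1 / 6 : ℚ) • L.map (Int.castRingHom ℚ)) * U := by
      rw [Matrix.smul_mul, e2, smul_smul]; norm_num
    calc r = (1 : Matrix (Fin r) (Fin r) ℚ).rank := by simp
      _ ≤ U.rank := by rw [this]; exact Matrix.rank_mul_le_right _ _
      _ ≤ Dq.rank := by rw [hU]; exact Matrix.rank_mul_le_left _ _

def look : List (ℕ × ℕ × ℤ) → ℕ → ℕ → ℤ
  | [], _, _ => 0
  | (a, b, z) :: l, i, j => if a = i ∧ b = j then z else look l i j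

def pr (n : ℕ) : Fin 3 × Fin 12 := (Fin.ofNat 3 (n / 12), Fin.ofNat 12 (n % 12))
def un (p : Fin 3 × Fin 12) : ℕ := 12 * p.1.val + p.2.val

def Jl1 : List ℕ := [0, 1, 5, 6, 8, 11, 12, 24]
def Vl1 : List (ℕ × ℕ × ℤ) := [(0, 0, 6), (1, 1, 6), (1, 29, 36), (2, 5, 6), (3, 6, 6), (4, 8,
  6), (4, 17, -36), (5, 11, 6), (5, 20, -9), (6, 12, 6), (7, 24, 6)]
def Ll1 : List (ℕ × ℕ × ℤ) := [(0, 1, -6), (1, 4, -6), (2, 6, -6), (3, 7, -6), (4, 9, -6), (5,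
  10, 3), (6, 2, -6), (7, 3, -6)]
def Jl2 : List ℕ := [0, 5, 8, 12, 13, 17, 18, 20, 24, 29, 30, 32, 35]
def Vl2 : List (ℕ × ℕ × ℤ) := [(0, 0, 6), (1, 5, 6), (1, 25, -1), (2, 8, 6), (2, 23, 4), (3,
  12, 6), (4, 13, 6), (5, 17, 6), (6, 18, 6), (7, 20, 6), (7, 25, 6), (8, 24, 6), (9, 29, 6),
  (10, 30, 6), (11, 32, 6), (12, 35, 6)]
def Ll2 : List (ℕ × ℕ × ℤ) := [(0, 15, -6), (1, 16, -1), (2, 34, 2), (3, 3, 6), (4, 28, -6),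
  (5, 4, 1), (6, 31, -6), (7, 16, 6), (7, 33, -6), (8, 2, -6), (9, 9, 1), (10, 19, 6), (11, 10,
  -2), (12, 22, -3)]
def Jl3 : List ℕ := [0, 1, 5, 6, 8, 11]
def Vl3 : List (ℕ × ℕ × ℤ) := [(0, 0, 6), (1, 1, 6), (2, 5, 6), (3, 6, 6), (4, 8, 6), (5, 11,
  6)]
def Ll3 : List (ℕ × ℕ × ℤ) := [(0, 1, -6), (1, 4, -6), (2, 6, -6), (3, 7, -6), (4, 9, -6), (5,
  10, 3)]

lemma rank1 : (D1 (fun _ => (0 : ℚ))).rank = 8 := by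
  have := rank_cert (r := 8) (D1 (fun _ => (0 : ℤ))) (fun i => pr (Jl1.getD i 0))
    (fun i q => look Vl1 i (un q)) (fun i q => look Ll1 i q) (by decide +kernel)
    (by decide +kernel)
  rw [D1_map] at this
  simpa using this

lemma rank2 : (D2 (fun _ => (0 : ℚ))).rank = 13 := by
  have := rank_cert (r := 13) (D2 (fun _ => (0 : ℤ))) (fun i => pr (Jl2.getD i 0))
    (fun i q => look Vl2 i (un q)) (fun i q => look Ll2 i (un q)) (by decide +kernel)
    (by decide +kernel)
  rw [D2_map] at this
  simpa using this

lemma rank3 : (D3 (fun _ => (0 : ℚ))).rank = 6 := by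
  have := rank_cert (r := 6) (D3 (fun _ => (0 : ℤ))) (fun i => Fin.ofNat 12 (Jl3.getD i 0))
    (fun i q => look Vl3 i q) (fun i q => look Ll3 i (un q)) (by decide +kernel)
    (by decide +kernel)
  rw [D3_map] at this
  simpa using this

end S19

namespace S19

section Mats
variable {R : Type} [CommRing R] (x : Fin 3 → R)

def YM (R : Type) [CommRing R] (k : Fin 3) : Matrix (Fin 12) (Fin 12) R :=
  (Xz k).map (Int.castRingHom R)

lemma YM_comm (k l : Fin 3) : Commute (YM R k) (YM R l) := by
  unfold YM Commute SemiconjBy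
  rw [← Matrix.map_mul, ← Matrix.map_mul, Xz_comm]

lemma YM_nil (k : Fin 3) : YM R k * YM R k * YM R k = 0 := by
  unfold YM
  rw [← Matrix.map_mul, ← Matrix.map_mul, Xz_nil]
  ext i j; simp

lemma FM_eq (k : Fin 3) : FM x k = x k • 1 - YM R k := rfl

def GM (k : Fin 3) : Matrix (Fin 12) (Fin 12) R :=
  x k ^ 2 • 1 + x k • YM R k + YM R k * YM R k

lemma GM_mul (k : Fin 3) : GM x k * FM x k = x k ^ 3 • 1 := by
  rw [FM_eq, GM]
  simp only [mul_sub, add_mul, YM_nil, Matrix.smul_mul, Matrix.mul_smul, mul_one, one_mul]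
  module

lemma smul_one_comm (a : R) (M : Matrix (Fin 12) (Fin 12) R) : Commute (a • 1) M := by
  unfold Commute SemiconjBy
  simp

lemma YF_comm (k l : Fin 3) : Commute (YM R k) (FM x l) := by
  rw [FM_eq]
  exact (smul_one_comm _ _).symm.sub_right (YM_comm k l)

lemma FF_comm (k l : Fin 3) : Commute (FM x k) (FM x l) := by
  rw [FM_eq x k]
  exact (smul_one_comm _ _).sub_left (YF_comm x k l)

lemma GF_comm (k l : Fin 3) : Commute (GM x k) (FM x l) := by
  rw [GM]
  exact ((smul_one_comm _ _).add_left ((YF_comm x k l).smul_left _)).add_left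
    ((YF_comm x k l).mul_left (YF_comm x k l))

def Fe (k : Fin 3) : Module.End R (Fin 12 → R) := (FM x k).mulVecLin
def Ge (k : Fin 3) : Module.End R (Fin 12 → R) := (GM x k).mulVecLin

lemma hGFe (k n) : Ge x k (Fe x k n) = x k ^ 3 • n := by
  simp only [Ge, Fe, Matrix.mulVecLin_apply, Matrix.mulVec_mulVec, GM_mul, Matrix.smul_mulVec,
    Matrix.one_mulVec]

lemma hFFe (k l n) : Fe x k (Fe x l n) = Fe x l (Fe x k n) := by
  simp only [Fe, Matrix.mulVecLin_apply, Matrix.mulVec_mulVec]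
  rw [(FF_comm x k l).eq]

lemma hCe (k l n) : Ge x k (Fe x l n) = Fe x l (Ge x k n) := by
  simp only [Fe, Ge, Matrix.mulVecLin_apply, Matrix.mulVec_mulVec]
  rw [(GF_comm x k l).eq]

def sl (v : Fin 3 × Fin 12 → R) (k : Fin 3) : Fin 12 → R := fun j => v (k, j)

lemma sl_ext {v w : Fin 3 × Fin 12 → R} (h0 : sl v 0 = sl w 0) (h1 : sl v 1 = sl w 1)
    (h2 : sl v 2 = sl w 2) : v = w := by
  funext ⟨k, j⟩
  fin_cases k
  · exact congrFun h0 j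
  · exact congrFun h1 j
  · exact congrFun h2 j

lemma D1_mulVec (v : Fin 3 × Fin 12 → R) :
    (D1 x).mulVec v = Fe x 0 (sl v 0) + Fe x 1 (sl v 1) + Fe x 2 (sl v 2) := by
  funext i
  simp only [Matrix.mulVec, dotProduct, Fintype.sum_prod_type, Fin.sum_univ_three, D1, Fe,
    Matrix.mulVecLin_apply, Pi.add_apply, sl]

lemma D2_mulVec (v : Fin 3 × Fin 12 → R) (k : Fin 3) :
    sl ((D2 x).mulVec v) k = Fe x (k + 1) (sl v (k + 2)) - Fe x (k + 2) (sl v (k + 1)) := by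
  funext i
  fin_cases k <;>
  simp [Matrix.mulVec, dotProduct, Fintype.sum_prod_type, Fin.sum_univ_three, D2, Fe,
    Matrix.mulVecLin_apply, Pi.sub_apply, sl] <;> ring_nf <;> rfl

lemma D3_mulVec (v : Fin 12 → R) (k : Fin 3) :
    sl ((D3 x).mulVec v) k = Fe x k v := rfl

lemma D12 (v : Fin 3 × Fin 12 → R) : (D1 x).mulVec ((D2 x).mulVec v) = 0 := by
  rw [D1_mulVec, D2_mulVec, D2_mulVec, D2_mulVec]
  simp only [map_sub, Fin.isValue, zero_add, show (1 : Fin 3) + 1 = 2 from rfl,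
    show (1 : Fin 3) + 2 = 0 from rfl, show (2 : Fin 3) + 1 = 0 from rfl,
    show (2 : Fin 3) + 2 = 1 from rfl]
  rw [hFFe x 1 0, hFFe x 2 0, hFFe x 2 1]
  abel

lemma D23 (v : Fin 12 → R) : (D2 x).mulVec ((D3 x).mulVec v) = 0 := by
  apply sl_ext <;> rw [D2_mulVec, D3_mulVec, D3_mulVec, hFFe, sub_self] <;> rfl

variable {x} (hx : Good x)
include hx

lemma exD1 (v : Fin 3 × Fin 12 → R) (h : (D1 x).mulVec v = 0) : ∃ w, (D2 x).mulVec w = v := by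
  rw [D1_mulVec] at h
  obtain ⟨a, b, c, h0, h1, h2⟩ := exact1 hx (Fe x) (Ge x) (hGFe x) (hFFe x) (hCe x) h
  refine ⟨fun p => ![a, b, c] p.1 p.2, sl_ext ?_ ?_ ?_⟩
  · rw [D2_mulVec, h0]; rfl
  · rw [D2_mulVec, h1]; rfl
  · rw [D2_mulVec, h2]; rfl

lemma exD2 (v : Fin 3 × Fin 12 → R) (h : (D2 x).mulVec v = 0) : ∃ w, (D3 x).mulVec w = v := by
  have h0 := D2_mulVec x v 0
  have h1 := D2_mulVec x v 1
  have h2 := D2_mulVec x v 2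
  rw [h] at h0 h1 h2
  obtain ⟨k, e0, e1, e2⟩ := exact2 hx (Fe x) (Ge x) (hGFe x) (hFFe x) (hCe x)
    h0.symm h1.symm h2.symm
  exact ⟨k, sl_ext e0.symm e1.symm e2.symm⟩

lemma exD3 (v : Fin 12 → R) (h : (D3 x).mulVec v = 0) : v = 0 := by
  apply reg1 hx (Fe x) (Ge x) (hGFe x) 0
  rw [← D3_mulVec, h, map_zero]; rfl

end Mats

end S19

namespace S19

def mkL (a b c d : A) : L' :=
  (Ideal.Quotient.mk J₁ a, Ideal.Quotient.mk J₁ b, Ideal.Quotient.mk J₂ c, Ideal.Quotient.mk J₃ d)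

lemma mkL_smul (p a b c d : A) : p • mkL a b c d = mkL (p * a) (p * b) (p * c) (p * d) := rfl

lemma mkL_add (a b c d a' b' c' d' : A) :
    mkL a b c d + mkL a' b' c' d' = mkL (a + a') (b + b') (c + c') (d + d') := rfl

lemma mkL_eq {a b c d a' b' c' d' : A} (h1 : a - a' ∈ J₁) (h2 : b - b' ∈ J₁) (h3 : c - c' ∈ J₂)
    (h4 : d - d' ∈ J₃) : mkL a b c d = mkL a' b' c' d' := by
  unfold mkL
  rw [Ideal.Quotient.eq.2 h1, Ideal.Quotient.eq.2 h2, Ideal.Quotient.eq.2 h3,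
    Ideal.Quotient.eq.2 h4]

lemma mkL_eq_iff {a b c d a' b' c' d' : A} : mkL a b c d = mkL a' b' c' d' ↔
    a - a' ∈ J₁ ∧ b - b' ∈ J₁ ∧ c - c' ∈ J₂ ∧ d - d' ∈ J₃ := by
  unfold mkL
  rw [Prod.mk.injEq, Prod.mk.injEq, Prod.mk.injEq, Ideal.Quotient.eq, Ideal.Quotient.eq,
    Ideal.Quotient.eq, Ideal.Quotient.eq]

lemma ρ₁_eq : ρ₁ = mkL 0 0 (2 * X 1) (3 * X 0) := rfl
lemma ρ₂_eq : ρ₂ = mkL 0 (X 1) (6 * X 0) 0 := rfl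
lemma ρ₃_eq : ρ₃ = mkL (-(6 : A) * X 0 ^ 2) (X 2) 0 0 := rfl

lemma J1g {p : A} (a b c d e f : A) (h : p = a * X 0 ^ 3 + b * X 1 ^ 2 + c * X 2 ^ 2 +
    d * (X 0 * X 1) + e * (X 0 * X 2) + f * (X 1 * X 2)) : p ∈ J₁ := by
  rw [h]
  unfold J₁
  refine Ideal.add_mem _ (Ideal.add_mem _ (Ideal.add_mem _ (Ideal.add_mem _ (Ideal.add_mem _
    ?_ ?_) ?_) ?_) ?_) ?_ <;>
  exact Ideal.mul_mem_left _ _ (Ideal.subset_span (by simp))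

lemma J2g {p : A} (a b c d : A) (h : p = a * X 0 ^ 2 + b * X 1 ^ 2 + c * (X 0 * X 1) +
    d * X 2) : p ∈ J₂ := by
  rw [h]
  unfold J₂
  refine Ideal.add_mem _ (Ideal.add_mem _ (Ideal.add_mem _ ?_ ?_) ?_) ?_ <;>
  exact Ideal.mul_mem_left _ _ (Ideal.subset_span (by simp))

lemma J3g {p : A} (a b c : A) (h : p = a * X 0 ^ 2 + b * X 1 + c * X 2) : p ∈ J₃ := by
  rw [h]
  unfold J₃
  refine Ideal.add_mem _ (Ideal.add_mem _ ?_ ?_) ?_ <;>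
  exact Ideal.mul_mem_left _ _ (Ideal.subset_span (by simp))

lemma triv1 (i : Fin 3) : (X i : A) • ρ₁ = 0 := by
  rw [ρ₁_eq, mkL_smul, show (0 : L') = mkL 0 0 0 0 from rfl]
  apply mkL_eq
  · simp
  · simp
  · fin_cases i
    · exact J2g 0 0 2 0 (by simp; ring)
    · exact J2g 0 2 0 0 (by simp; ring)
    · exact J2g 0 0 0 (2 * X 1) (by simp; ring)
  · fin_cases i
    · exact J3g 3 0 0 (by simp; ring)
    · exact J3g 0 (3 * X 0) 0 (by simp; ring)
    · exact J3g 0 0 (3 * X 0) (by simp; ring)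

lemma triv2 (i : Fin 3) : (X i : A) • ρ₂ = 0 := by
  rw [ρ₂_eq, mkL_smul, show (0 : L') = mkL 0 0 0 0 from rfl]
  apply mkL_eq
  · simp
  · fin_cases i
    · exact J1g 0 0 0 1 0 0 (by simp)
    · exact J1g 0 1 0 0 0 0 (by simp; ring)
    · exact J1g 0 0 0 0 0 1 (by simp; ring)
  · fin_cases i
    · exact J2g 6 0 0 0 (by simp; ring)
    · exact J2g 0 0 6 0 (by simp; ring)
    · exact J2g 0 0 0 (6 * X 0) (by simp; ring)
  · simp

lemma triv3 (i : Fin 3) : (X i : A) • ρ₃ = 0 := by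
  rw [ρ₃_eq, mkL_smul, show (0 : L') = mkL 0 0 0 0 from rfl]
  apply mkL_eq
  · fin_cases i
    · exact J1g (-6) 0 0 0 0 0 (by simp; ring)
    · exact J1g 0 0 0 (-6 * X 0) 0 0 (by simp; ring)
    · exact J1g 0 0 0 0 (-6 * X 0) 0 (by simp; ring)
  · fin_cases i
    · exact J1g 0 0 0 0 1 0 (by simp)
    · exact J1g 0 0 0 0 0 1 (by simp)
    · exact J1g 0 0 1 0 0 0 (by simp; ring)
  · simp
  · simp

/-- third of one, as a constant polynomial -/
def th : A := C (1 / 3)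
lemma th3 : 3 * th = 1 := by
  unfold th
  rw [show (3 : A) = C 3 from (map_ofNat C 3).symm, ← C_mul]; norm_num

abbrev Mq : Type := L' ⧸ K'

def bq (a b c d : A) : Mq := K'.mkQ (mkL a b c d)

lemma bq_smul (p a b c d : A) : p • bq a b c d = bq (p * a) (p * b) (p * c) (p * d) := rfl
lemma bq_add (a b c d a' b' c' d' : A) :
    bq a b c d + bq a' b' c' d' = bq (a + a') (b + b') (c + c') (d + d') := rfl

lemma bq_eq_iff {a b c d a' b' c' d' : A} : bq a b c d = bq a' b' c' d' ↔
    ∃ r s t : A, a - a' + 6 * t * X 0 ^ 2 ∈ J₁ ∧ b - b' - s * X 1 - t * X 2 ∈ J₁ ∧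
      c - c' - 2 * r * X 1 - 6 * s * X 0 ∈ J₂ ∧ d - d' - 3 * r * X 0 ∈ J₃ := by
  have h0 : bq a b c d = bq a' b' c' d' ↔ mkL (a - a') (b - b') (c - c') (d - d') ∈ K' :=
    Submodule.Quotient.eq K'
  have h1 : mkL (a - a') (b - b') (c - c') (d - d') ∈ K' ↔ ∃ r s t : A,
      r • ρ₁ + s • ρ₂ + t • ρ₃ = mkL (a - a') (b - b') (c - c') (d - d') :=
    Submodule.mem_span_triple
  rw [h0, h1]
  refine exists_congr fun r => exists_congr fun s => exists_congr fun t => ?_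
  rw [ρ₁_eq, ρ₂_eq, ρ₃_eq, mkL_smul, mkL_smul, mkL_smul, mkL_add, mkL_add, eq_comm, mkL_eq_iff]
  ring_nf

/-- the basis of `𝔏'/𝔎'` -/
def bb : Fin 12 → Mq :=
  ![bq 1 0 0 0, bq (X 0) 0 0 0, bq (X 1) 0 0 0, bq (X 2) 0 0 0, bq (X 0 ^ 2) 0 0 0,
    bq 0 1 0 0, bq 0 (X 0) 0 0, bq 0 (X 0 ^ 2) 0 0,
    bq 0 0 1 0, bq 0 0 (X 0) 0, bq 0 0 (th * X 1) 0, bq 0 0 0 1]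

lemma bq_z1 {a : A} (h : a ∈ J₁) : bq a 0 0 0 = 0 :=
  bq_eq_iff (a' := 0) (b' := 0) (c' := 0) (d' := 0) |>.2 ⟨0, 0, 0, by simpa using h, by simp⟩
lemma bq_z2 {a : A} (h : a ∈ J₁) : bq 0 a 0 0 = 0 :=
  bq_eq_iff (a' := 0) (b' := 0) (c' := 0) (d' := 0) |>.2 ⟨0, 0, 0, by simp, by simpa using h, by simp⟩
lemma bq_z3 {a : A} (h : a ∈ J₂) : bq 0 0 a 0 = 0 :=
  bq_eq_iff (a' := 0) (b' := 0) (c' := 0) (d' := 0) |>.2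
    ⟨0, 0, 0, by simp, by simp, by simpa using h, by simp⟩
lemma bq_z4 {a : A} (h : a ∈ J₃) : bq 0 0 0 a = 0 :=
  bq_eq_iff (a' := 0) (b' := 0) (c' := 0) (d' := 0) |>.2
    ⟨0, 0, 0, by simp, by simp, by simp, by simpa using h⟩

def tgt : ℕ → ℕ → ℤ × Fin 12
  | 0, 0 => (1, 1)
  | 0, 1 => (1, 4)
  | 0, 5 => (1, 6)
  | 0, 6 => (1, 7)
  | 0, 8 => (1, 9)
  | 0, 11 => (-2, 10)
  | 1, 0 => (1, 2)
  | 1, 5 => (-6, 9)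
  | 1, 8 => (3, 10)
  | 2, 0 => (1, 3)
  | 2, 5 => (6, 4)
  | _, _ => (0, 0)

lemma Xz_tgt : ∀ (k : Fin 3) (i j : Fin 12),
    Xz k i j = if i = (tgt k j).2 then (tgt k j).1 else 0 := by
  have h : ∀ k : Fin 3, ∀ i : Fin 12, ∀ j : Fin 12,
    Xe k i j = if i = (tgt k j).2 then (tgt k j).1 else 0 := by decide +kernel
  exact h

lemma act0 : ∀ j : Fin 12, (X 0 : A) • bb j = ((tgt 0 j).1 : A) • bb (tgt 0 j).2 := by
  intro j
  fin_cases j <;> simp only [bb, tgt] <;> simp [bq_smul]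
  · ring_nf
  · exact bq_z1 (J1g 0 0 0 1 0 0 (by ring))
  · exact bq_z1 (J1g 0 0 0 0 1 0 (by ring))
  · exact bq_z1 (J1g 1 0 0 0 0 0 (by ring))
  · ring_nf
  · exact bq_z2 (J1g 1 0 0 0 0 0 (by ring))
  · exact bq_z3 (J2g 1 0 0 0 (by ring))
  · exact bq_z3 (J2g 0 0 th 0 (by ring))
  · exact bq_eq_iff.2 ⟨th, 0, 0, by simp, by simp, by ring_nf; simp, by
      rw [th3]; simp⟩

lemma act1 : ∀ j : Fin 12, (X 1 : A) • bb j = ((tgt 1 j).1 : A) • bb (tgt 1 j).2 := by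
  intro j
  fin_cases j <;> simp only [bb, tgt] <;> simp [bq_smul]
  · exact bq_z1 (J1g 0 0 0 1 0 0 (by ring))
  · exact bq_z1 (J1g 0 1 0 0 0 0 (by ring))
  · exact bq_z1 (J1g 0 0 0 0 0 1 (by ring))
  · exact bq_z1 (J1g 0 0 0 (X 0) 0 0 (by ring))
  · exact bq_eq_iff.2 ⟨0, 1, 0, by simp, by simp, by ring_nf; simp, by simp⟩
  · exact bq_z2 (J1g 0 0 0 1 0 0 (by ring))
  · exact bq_z2 (J1g 0 0 0 (X 0) 0 0 (by ring))
  · rw [← mul_assoc, th3, one_mul]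
  · exact bq_z3 (J2g 0 0 1 0 (by ring))
  · exact bq_z3 (J2g 0 th 0 0 (by ring))
  · exact bq_z4 (J3g 0 1 0 (by ring))

lemma act2 : ∀ j : Fin 12, (X 2 : A) • bb j = ((tgt 2 j).1 : A) • bb (tgt 2 j).2 := by
  intro j
  fin_cases j <;> simp only [bb, tgt] <;> simp [bq_smul]
  · exact bq_z1 (J1g 0 0 0 0 1 0 (by ring))
  · exact bq_z1 (J1g 0 0 0 0 0 1 (by ring))
  · exact bq_z1 (J1g 0 0 1 0 0 0 (by ring))
  · exact bq_z1 (J1g 0 0 0 0 (X 0) 0 (by ring))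
  · exact bq_eq_iff.2 ⟨0, 0, 1, by ring_nf; simp, by simp, by simp, by simp⟩
  · exact bq_z2 (J1g 0 0 0 0 1 0 (by ring))
  · exact bq_z2 (J1g 0 0 0 0 (X 0) 0 (by ring))
  · exact bq_z3 (J2g 0 0 0 1 (by ring))
  · exact bq_z3 (J2g 0 0 0 (X 0) (by ring))
  · exact bq_z3 (J2g 0 0 0 (th * X 1) (by ring))
  · exact bq_z4 (J3g 0 0 1 (by ring))

lemma act (k : Fin 3) (j : Fin 12) :
    (X k : A) • bb j = ∑ i, ((Xz k i j : ℤ) : A) • bb i := by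
  have h : (X k : A) • bb j = ((tgt k j).1 : A) • bb (tgt k j).2 := by
    fin_cases k
    · exact act0 j
    · exact act1 j
    · exact act2 j
  rw [h, Finset.sum_eq_single (tgt k j).2]
  · rw [Xz_tgt, if_pos rfl]
  · intro i _ hi
    rw [Xz_tgt, if_neg hi, Int.cast_zero, zero_smul]
  · simp

end S19

namespace S19

section Red
variable {R : Type} [CommRing R] (x : Fin 3 → R) {S : Type} [CommRing S] (g : S →+* R)

/-- `v` is congruent to a constant vector modulo the range of `D1`. -/
def Red (v : Fin 12 → R) : Prop :=
  ∃ (c : Fin 12 → S) (w : Fin 3 × Fin 12 → R), v = (fun i => g (c i)) + (D1 x).mulVec w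

lemma Red.add {v v' : Fin 12 → R} (h : Red x g v) (h' : Red x g v') : Red x g (v + v') := by
  obtain ⟨c, w, rfl⟩ := h
  obtain ⟨c', w', rfl⟩ := h'
  refine ⟨c + c', w + w', ?_⟩
  rw [Matrix.mulVec_add]
  ext i
  simp
  ring

lemma Red.const (c : Fin 12 → S) : Red x g (fun i => g (c i)) :=
  ⟨c, 0, by rw [Matrix.mulVec_zero, add_zero]⟩

lemma D1_one (k : Fin 3) (u : Fin 12 → R) :
    (D1 x).mulVec (fun q => if q.1 = k then u q.2 else 0) = (FM x k).mulVec u := by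
  ext i
  simp only [Matrix.mulVec, dotProduct, Fintype.sum_prod_type, Fin.sum_univ_three, D1]
  fin_cases k <;> simp

lemma Red.smulX {v : Fin 12 → R} (h : Red x g v) (k : Fin 3) : Red x g (x k • v) := by
  obtain ⟨c, w, rfl⟩ := h
  refine ⟨(YM S k).mulVec c, x k • w + (fun q => if q.1 = k then g (c q.2) else 0), ?_⟩
  rw [Matrix.mulVec_add, Matrix.mulVec_smul, D1_one x k (fun i => g (c i)), FM_eq,
    Matrix.sub_mulVec, Matrix.smul_mulVec, Matrix.one_mulVec]
  have : (fun i => g ((YM S k).mulVec c i)) = (YM R k).mulVec (fun i => g (c i)) := by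
    ext i
    simp [Matrix.mulVec, dotProduct, YM]
  rw [this, smul_add]
  abel

lemma Red.zero : Red x g 0 := ⟨0, 0, by ext; simp⟩

lemma Red.sum {v : Fin 12 → R} (h : ∀ i, Red x g (Pi.single i (v i))) : Red x g v := by
  rw [← Finset.univ_sum_single v]
  exact Finset.sum_induction _ (Red x g) (fun _ _ h h' => h.add x g h') (Red.zero x g)
    (fun i _ => h i)

variable {N : Type} [AddCommGroup N] [Module R N] (b : Fin 12 → N)

def lc : (Fin 12 → R) →ₗ[R] N := Fintype.linearCombination R b

lemma lc_apply (v : Fin 12 → R) : lc b v = ∑ i, v i • b i := rfl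

lemma lc_D1 (h : ∀ k j, x k • b j = ∑ i, ((Xz k i j : ℤ) : R) • b i) (v) :
    lc b ((D1 x).mulVec v) = 0 := by
  have key : ∀ k u, lc b ((FM x k).mulVec u) = 0 := by
    intro k u
    rw [FM_eq, Matrix.sub_mulVec, Matrix.smul_mulVec, Matrix.one_mulVec, map_sub, sub_eq_zero,
      lc_apply, lc_apply]
    have e1 : ∀ i, (YM R k).mulVec u i • b i = ∑ j, u j • ((Xz k i j : ℤ) : R) • b i := by
      intro i
      rw [Matrix.mulVec, dotProduct, Finset.sum_smul]
      refine Finset.sum_congr rfl fun j _ => ?_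
      rw [smul_smul, mul_comm]; rfl
    simp_rw [e1]
    rw [Finset.sum_comm]
    refine Finset.sum_congr rfl fun j _ => ?_
    rw [← Finset.smul_sum, ← h, Pi.smul_apply, smul_eq_mul, mul_comm, mul_smul]
  rw [D1_mulVec, map_add, map_add]
  simp only [Fe, Matrix.mulVecLin_apply, key, add_zero]

end Red

lemma redA (v : Fin 12 → A) : Red (fun k => (X k : A)) (C : ℚ →+* A) v := by
  apply Red.sum
  intro i
  induction v i using MvPolynomial.induction_on with
  | C a =>
    have := Red.const (fun k => (X k : A)) (C : ℚ →+* A) (Pi.single i a)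
    convert this using 1
    ext j
    rcases eq_or_ne j i with rfl | h
    · simp
    · simp [h]
  | add p q hp hq =>
    rw [Pi.single_add]
    exact hp.add _ _ hq
  | mul_X p k hp =>
    have := hp.smulX _ _ k
    convert this using 1
    ext j
    rcases eq_or_ne j i with rfl | h
    · rw [Pi.single_eq_same, Pi.smul_apply, Pi.single_eq_same, smul_eq_mul, mul_comm]
    · rw [Pi.single_eq_of_ne h, Pi.smul_apply, Pi.single_eq_of_ne h, smul_eq_mul, mul_zero]

/-! Functionals detecting the basis -/

def f0 (p : A) : ℚ := constantCoeff p
def f1 (k : Fin 3) (p : A) : ℚ := constantCoeff (pderiv k p)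
def f2 (p : A) : ℚ := constantCoeff (pderiv 0 (pderiv 0 p))

lemma J1f {p : A} (h : p ∈ J₁) : f0 p = 0 ∧ (∀ k, f1 k p = 0) ∧ f2 p = 0 := by
  unfold J₁ at h
  induction h using Submodule.span_induction with
  | mem y hy =>
    simp only [Set.mem_insert_iff, Set.mem_singleton_iff] at hy
    rcases hy with rfl | rfl | rfl | rfl | rfl | rfl <;>
    simp [f0, f1, f2, Derivation.leibniz, Derivation.leibniz_pow, pderiv_X, Pi.single_apply] <;>
    intro k <;> fin_cases k <;> simp
  | zero => simp [f0, f1, f2]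
  | add y z _ _ hy hz =>
    refine ⟨?_, fun k => ?_, ?_⟩
    · have := hy.1; have := hz.1; simp_all [f0]
    · have := hy.2.1 k; have := hz.2.1 k; simp_all [f1]
    · have := hy.2.2; have := hz.2.2; simp_all [f2]
  | smul a y _ hy =>
    obtain ⟨h0, h1, h2⟩ := hy
    have h10 := h1 0
    unfold f0 at h0
    unfold f2 at h2
    unfold f1 at h10
    rw [show a • y = a * y from rfl]
    refine ⟨?_, fun k => ?_, ?_⟩
    · simp [f0, h0]
    · have := h1 k
      unfold f1 at this
      simp [f1, Derivation.leibniz, this, h0]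
    · simp [f2, Derivation.leibniz, h10, h0, h2]

lemma J2f {p : A} (h : p ∈ J₂) : f0 p = 0 ∧ f1 0 p = 0 ∧ f1 1 p = 0 := by
  unfold J₂ at h
  induction h using Submodule.span_induction with
  | mem y hy =>
    simp only [Set.mem_insert_iff, Set.mem_singleton_iff] at hy
    rcases hy with rfl | rfl | rfl | rfl <;>
    simp [f0, f1, Derivation.leibniz, Derivation.leibniz_pow, pderiv_X, Pi.single_apply]
  | zero => simp [f0, f1]
  | add y z _ _ hy hz =>
    refine ⟨?_, ?_, ?_⟩
    · have := hy.1; have := hz.1; simp_all [f0]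
    · have := hy.2.1; have := hz.2.1; simp_all [f1]
    · have := hy.2.2; have := hz.2.2; simp_all [f1]
  | smul a y _ hy =>
    obtain ⟨h0, h1, h2⟩ := hy
    unfold f0 at h0
    unfold f1 at h1 h2
    rw [show a • y = a * y from rfl]
    refine ⟨?_, ?_, ?_⟩
    · simp [f0, h0]
    · simp [f1, Derivation.leibniz, h1, h0]
    · simp [f1, Derivation.leibniz, h0, h2]

lemma J3f {p : A} (h : p ∈ J₃) : f0 p = 0 ∧ f1 0 p = 0 := by
  unfold J₃ at h
  induction h using Submodule.span_induction with
  | mem y hy =>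
    simp only [Set.mem_insert_iff, Set.mem_singleton_iff] at hy
    rcases hy with rfl | rfl | rfl <;>
    simp [f0, f1, Derivation.leibniz, Derivation.leibniz_pow, pderiv_X, Pi.single_apply]
  | zero => simp [f0, f1]
  | add y z _ _ hy hz =>
    refine ⟨?_, ?_⟩
    · have := hy.1; have := hz.1; simp_all [f0]
    · have := hy.2; have := hz.2; simp_all [f1]
  | smul a y _ hy =>
    obtain ⟨h0, h1⟩ := hy
    unfold f0 at h0
    unfold f1 at h1
    rw [show a • y = a * y from rfl]
    refine ⟨?_, ?_⟩
    · simp [f0, h0]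
    · simp [f1, Derivation.leibniz, h1, h0]

lemma lc_bb (v : Fin 12 → A) : lc bb v =
    bq (v 0 + v 1 * X 0 + v 2 * X 1 + v 3 * X 2 + v 4 * X 0 ^ 2)
      (v 5 + v 6 * X 0 + v 7 * X 0 ^ 2)
      (v 8 + v 9 * X 0 + v 10 * (th * X 1)) (v 11) := by
  rw [lc_apply]
  simp only [Fin.sum_univ_succ, Fin.sum_univ_zero]
  simp only [bb, bq_smul]
  simp [bq_smul, bq_add]
  ring_nf

lemma bb_indep (c : Fin 12 → ℚ) (h : lc bb (fun i => (C (c i) : A)) = 0) : c = 0 := by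
  rw [lc_bb] at h
  obtain ⟨r, s, t, h1, h2, h3, h4⟩ := (bq_eq_iff (a' := 0) (b' := 0) (c' := 0) (d' := 0)).1 h
  obtain ⟨a0, a1, a2⟩ := J1f h1
  have a10 := a1 0
  have a11 := a1 1
  have a12 := a1 2
  obtain ⟨b0, b1, b2⟩ := J1f h2
  have b10 := b1 0
  have b11 := b1 1
  have b12 := b1 2
  obtain ⟨c0, c1, c2⟩ := J2f h3
  obtain ⟨d0, d1⟩ := J3f h4
  clear a1 b1 h1 h2 h3 h4 h
  have e6 : constantCoeff (6 : A) = (6 : ℚ) := map_ofNat constantCoeff 6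
  have e3 : constantCoeff (3 : A) = (3 : ℚ) := map_ofNat constantCoeff 3
  have e2 : constantCoeff (2 : A) = (2 : ℚ) := map_ofNat constantCoeff 2
  simp [e6, e3, e2, f0, f1, f2, th, Derivation.leibniz, Derivation.leibniz_pow, pderiv_X, Pi.single_apply]
    at a0 a10 a11 a12 a2 b0 b10 b11 b12 b2 c0 c1 c2 d0 d1
  ext i
  fin_cases i <;> simp <;> linarith


lemma lc_surj : Function.Surjective (lc bb : (Fin 12 → A) →ₗ[A] Mq) := by
  intro m
  obtain ⟨⟨a, b, c, d⟩, rfl⟩ := Submodule.mkQ_surjective K' m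
  obtain ⟨a, rfl⟩ := Ideal.Quotient.mk_surjective a
  obtain ⟨b, rfl⟩ := Ideal.Quotient.mk_surjective b
  obtain ⟨c, rfl⟩ := Ideal.Quotient.mk_surjective c
  obtain ⟨d, rfl⟩ := Ideal.Quotient.mk_surjective d
  refine ⟨![a, 0, 0, 0, 0, b, 0, 0, c, 0, 0, d], ?_⟩
  rw [lc_bb]
  simp
  rfl

lemma lc_ker (v : Fin 12 → A) (h : lc bb v = 0) :
    ∃ w, (D1 (fun k => (X k : A))).mulVec w = v := by
  obtain ⟨c, w, rfl⟩ := redA v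
  rw [map_add, lc_D1 _ _ act, add_zero] at h
  refine ⟨w, ?_⟩
  rw [bb_indep c h]
  ext i
  simp

end S19

namespace S19

open CategoryTheory Limits

section PR
variable {R : Type} [CommRing R]

/-- a projective resolution from an exact complex of projectives -/
def mkPR (K : ChainComplex (ModuleCat.{0} R) ℕ) (Z : ModuleCat.{0} R) (p : K.X 0 ⟶ Z)
    (w : K.d 1 0 ≫ p = 0) (hp : Epi p) (h0 : (ShortComplex.mk _ _ w).Exact)
    (hK : ∀ n, K.ExactAt (n + 1)) (hP : ∀ n, Projective (K.X n)) : ProjectiveResolution Z where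
  complex := K
  projective := hP
  π := (ChainComplex.toSingle₀Equiv K Z).symm ⟨p, w⟩
  quasiIso := ⟨fun n => by
    cases n with
    | zero =>
      rw [ChainComplex.quasiIsoAt₀_iff, ShortComplex.quasiIso_iff_of_zeros']
      · refine (ShortComplex.exact_and_epi_g_iff_of_iso (?_ : _ ≅ ShortComplex.mk _ _ w)).2
          ⟨h0, hp⟩
        exact ShortComplex.isoMk (Iso.refl _) (Iso.refl _) (Iso.refl _)
          ((Category.id_comp _).trans (Category.comp_id _).symm)
          ((Category.id_comp _).trans (Category.comp_id _).symm)
      · exact K.shape 0 0 (by simp)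
      · rfl
      · rfl
    | succ n =>
      rw [quasiIsoAt_iff_exactAt']
      · exact hK n
      · apply ChainComplex.exactAt_succ_single_obj⟩

def Fr (R : Type) [CommRing R] (ι : Type) : ModuleCat.{0} R := ModuleCat.of R (ι → R)

def mv {m n : Type} [Fintype n] (D : Matrix m n R) : Fr R n ⟶ Fr R m :=
  ModuleCat.ofHom D.mulVecLin

lemma mv_apply {m n : Type} [Fintype n] (D : Matrix m n R) (v : n → R) :
   (mv D) v = D.mulVec v := rfl

def KX (R : Type) [CommRing R] : ℕ → ModuleCat.{0} R
  | 0 => Fr R (Fin 12)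
  | 1 => Fr R (Fin 3 × Fin 12)
  | 2 => Fr R (Fin 3 × Fin 12)
  | 3 => Fr R (Fin 12)
  | _ => Fr R Empty

def Kd (x : Fin 3 → R) : ∀ n, KX R (n + 1) ⟶ KX R n
  | 0 => mv (D1 x)
  | 1 => mv (D2 x)
  | 2 => mv (D3 x)
  | _ + 3 => 0

lemma Kdd (x : Fin 3 → R) : ∀ n, Kd x (n + 1) ≫ Kd x n = 0
  | 0 => by ext v; exact D12 x v
  | 1 => by ext v; exact D23 x v
  | 2 => zero_comp
  | _ + 3 => zero_comp

def KC (x : Fin 3 → R) : ChainComplex (ModuleCat.{0} R) ℕ := ChainComplex.of (KX R) (Kd x) (Kdd x)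

lemma KC_d (x : Fin 3 → R) (n : ℕ) : (KC x).d (n + 1) n = Kd x n := ChainComplex.of_d _ _ _

instance projFr (ι : Type) [Fintype ι] : Projective (Fr R ι) :=
  (IsProjective.iff_projective (R := R) (ι → R)).1 inferInstance

lemma KX_proj : ∀ n, Projective (KX R n)
  | 0 => projFr _
  | 1 => projFr _
  | 2 => projFr _
  | 3 => projFr _
  | _ + 4 => projFr _

lemma KX_sub : ∀ n, Subsingleton (KX R (n + 4)) := fun _ =>
  (inferInstance : Subsingleton (Empty → R))

lemma KC_exact {x : Fin 3 → R} (hx : Good x) (n : ℕ) : (KC x).ExactAt (n + 1) := by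
  rw [HomologicalComplex.exactAt_iff' _ (n + 1 + 1) (n + 1) n (by simp) (by simp),
    ShortComplex.moduleCat_exact_iff]
  have key : ∀ (n : ℕ) (v : KX R (n + 1)), Kd x n v = 0 → ∃ w, Kd x (n + 1) w = v := by
    intro n v h
    match n with
    | 0 => exact exD1 hx v h
    | 1 => exact exD2 hx v h
    | 2 => exact ⟨0, by rw [map_zero]; exact (exD3 hx v h).symm⟩
    | n + 3 => exact ⟨0, (KX_sub n).elim _ _⟩
  intro v hv
  have h1 : (KC x).d (n + 1) n v = 0 := hv
  rw [KC_d] at h1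
  obtain ⟨w, hw⟩ := key n v h1
  refine ⟨w, ?_⟩
  have : (KC x).d (n + 1 + 1) (n + 1) w = v := by rw [KC_d]; exact hw
  exact this

end PR

/-- the resolution of `M19` -/
def PM : ProjectiveResolution M19 :=
  mkPR (KC (fun k => (X k : A))) M19 (ModuleCat.ofHom (lc bb : (Fin 12 → A) →ₗ[A] Mq) :
      Fr A (Fin 12) ⟶ ModuleCat.of A Mq)
    (by
      rw [KC_d]
      ext v
      exact lc_D1 _ _ act v)
    ((ModuleCat.epi_iff_surjective _).2 lc_surj)
    (by
      rw [ShortComplex.moduleCat_exact_iff]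
      intro v hv
      obtain ⟨w, hw⟩ := lc_ker v hv
      refine ⟨w, ?_⟩
      have : (KC (fun k => (X k : A))).d 1 0 w = v := by rw [KC_d]; exact hw
      exact this)
    (KC_exact goodX) KX_proj

lemma PM_complex : PM.complex = KC (fun k => (X k : A)) := rfl
end S19

namespace S19

open CategoryTheory Limits TensorProduct MonoidalCategory

section Hom
variable {R : Type} [CommRing R] {k : Type} [Field k] [Module R k] (g : R →+* k) (a : k →+* R)

lemma fr {m n l : Type} [Fintype m] [Fintype n] [Fintype l] (M1 : Matrix m n k) (M2 : Matrix l m k)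
    {W : Type} [AddCommGroup W] [Module k W] (p : LinearMap.ker M2.mulVecLin →ₗ[k] W)
    (hp : Function.Surjective p) (hM : ∀ w, M2.mulVec (M1.mulVec w) = 0)
    (hk : ∀ c, p c = 0 ↔ ∃ w, M1.mulVec w = c.1) :
    Module.finrank k W + M1.rank + M2.rank = Fintype.card m := by
  have h1 := LinearMap.finrank_range_add_finrank_ker p
  have h2 := LinearMap.finrank_range_add_finrank_ker M2.mulVecLin
  rw [LinearMap.range_eq_top.2 hp, finrank_top] at h1
  have h3 : Module.finrank k (LinearMap.ker p) = M1.rank := by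
    have : (LinearMap.ker p).map (LinearMap.ker M2.mulVecLin).subtype
        = LinearMap.range M1.mulVecLin := by
      ext c
      simp only [Submodule.mem_map, LinearMap.mem_ker, hk, LinearMap.mem_range]
      constructor
      · rintro ⟨y, ⟨w, hw⟩, rfl⟩
        exact ⟨w, hw⟩
      · rintro ⟨w, rfl⟩
        exact ⟨⟨M1.mulVecLin w, hM w⟩, ⟨w, rfl⟩, rfl⟩
    rw [Matrix.rank, ← this]
    exact (LinearEquiv.finrank_eq
      (Submodule.equivMapOfInjective _ (Submodule.subtype_injective _) _))
  rw [Module.finrank_pi] at h2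
  rw [← h3, ← h2, ← h1, Matrix.rank]
  omega

lemma frS (hg : ∀ (r : R) (c : k), r • c = g r * c) (ha : ∀ c, g (a c) = c)
    (S : ShortComplex (ModuleCat.{0} R)) {m n l : Type} [Fintype m] [Fintype n] [Fintype l]
    (M1 : Matrix m n k) (M2 : Matrix l m k)
    (e1 : S.X₁ ≃ₗ[R] (n → k)) (e2 : S.X₂ ≃ₗ[R] (m → k)) (e3 : S.X₃ ≃ₗ[R] (l → k))
    (h1 : ∀ v, e2 (S.f v) = M1.mulVec (e1 v)) (h2 : ∀ v, e3 (S.g v) = M2.mulVec (e2 v)) :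
    Module.finrank k ((ModuleCat.restrictScalars a).obj S.homology) + M1.rank + M2.rank
      = Fintype.card m := by
  let Z := LinearMap.ker S.g.hom
  let q : Z →ₗ[R] S.homology :=
    (S.moduleCatHomologyIso.toLinearEquiv.symm.toLinearMap).comp
      (LinearMap.range S.moduleCatToCycles).mkQ
  have hq : Function.Surjective q :=
    S.moduleCatHomologyIso.toLinearEquiv.symm.surjective.comp (Submodule.mkQ_surjective _)
  have hq0 : ∀ z : Z, q z = 0 ↔ ∃ v, S.f v = z.1 := by
    intro z
    have : q z = 0 ↔ (LinearMap.range S.moduleCatToCycles).mkQ z = 0 :=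
      LinearEquiv.map_eq_zero_iff S.moduleCatHomologyIso.toLinearEquiv.symm
    rw [this, Submodule.mkQ_apply, Submodule.Quotient.mk_eq_zero, LinearMap.mem_range]
    refine exists_congr fun v => ?_
    rw [Subtype.ext_iff]
    rfl
  have hz : ∀ c : LinearMap.ker M2.mulVecLin, e2.symm c.1 ∈ Z := by
    intro c
    have : S.g (e2.symm c.1) = 0 := by
      apply e3.injective
      rw [h2, LinearEquiv.apply_symm_apply, map_zero]
      exact c.2
    exact this
  have hsm : ∀ (c : k) (v : m → k), c • v = a c • v := by
    intro c v
    ext i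
    rw [Pi.smul_apply, Pi.smul_apply, hg, ha, smul_eq_mul]
  let p : LinearMap.ker M2.mulVecLin →ₗ[k] ((ModuleCat.restrictScalars a).obj S.homology) :=
    { toFun := fun c => (q ⟨e2.symm c.1, hz c⟩ : S.homology)
      map_add' := by
        intro c d
        have : (⟨e2.symm (c + d).1, hz (c + d)⟩ : Z) = ⟨e2.symm c.1, hz c⟩ + ⟨e2.symm d.1, hz d⟩ := by
          apply Subtype.ext
          exact map_add e2.symm c.1 d.1
        rw [this]
        exact map_add q _ _
      map_smul' := by
        intro r c
        have : (⟨e2.symm (r • c).1, hz (r • c)⟩ : Z) = a r • ⟨e2.symm c.1, hz c⟩ := by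
          apply Subtype.ext
          change e2.symm (r • c.1) = a r • e2.symm c.1
          rw [hsm, map_smul]
        rw [this]
        exact map_smul q _ _ }
  refine fr M1 M2 p ?_ ?_ ?_
  · intro w
    obtain ⟨z, hz'⟩ := hq w
    have hzz : S.g z.1 = 0 := z.2
    refine ⟨⟨e2 z.1, ?_⟩, ?_⟩
    · change M2.mulVec (e2 z.1) = 0
      rw [← h2, hzz, map_zero]
    · rw [← hz']
      change q _ = q z
      congr 1
      apply Subtype.ext
      exact e2.symm_apply_apply _
  · intro w
    have := h2 (S.f (e1.symm w))
    rw [h1, LinearEquiv.apply_symm_apply] at this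
    rw [← this, S.moduleCat_zero_apply, map_zero]
  · intro c
    have : p c = 0 ↔ q ⟨e2.symm c.1, hz c⟩ = 0 := Iff.rfl
    rw [this, hq0]
    constructor
    · rintro ⟨v, hv⟩
      refine ⟨e1 v, ?_⟩
      rw [← h1, hv, LinearEquiv.apply_symm_apply]
    · rintro ⟨w, hw⟩
      refine ⟨e1.symm w, ?_⟩
      apply e2.injective
      rw [h1, LinearEquiv.apply_symm_apply, LinearEquiv.apply_symm_apply, hw]

/-- tensoring a free module -/
def te (k : Type) [Field k] [Module R k] (ι : Type) [Fintype ι] [DecidableEq ι] :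
    (((tensoringLeft (ModuleCat.{0} R)).obj (ModuleCat.of R k)).obj (Fr R ι) : ModuleCat R) ≃ₗ[R]
      (ι → k) :=
  TensorProduct.piScalarRight R R k ι

lemma te_mv (hg : ∀ (r : R) (c : k), r • c = g r * c) {m n : Type} [Fintype m] [DecidableEq m] [Fintype n] [DecidableEq n] (D : Matrix m n R)
    (v) : te k m (((tensoringLeft (ModuleCat.{0} R)).obj (ModuleCat.of R k)).map (mv D) v)
      = (D.map g).mulVec (te k n v) := by
  induction v using TensorProduct.induction_on with
  | zero => simp
  | add x y hx hy => rw [map_add, map_add, map_add, hx, hy, Matrix.mulVec_add]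
  | tmul c v =>
    have H : ∀ (c : k) (v : n → R),
        (fun j => D.mulVec v j • c) = (D.map g).mulVec (fun j => v j • c) := by
      intro c v
      ext i
      simp only [hg, Matrix.mulVec, dotProduct, map_sum, map_mul, Finset.sum_mul,
        Matrix.map_apply, mul_assoc]
    exact H c v

/-- the tensored complex -/
def TC (k : Type) [Field k] [Module R k] (x : Fin 3 → R) : ChainComplex (ModuleCat.{0} R) ℕ :=
  (((tensoringLeft (ModuleCat.{0} R)).obj (ModuleCat.of R k)).mapHomologicalComplex _).obj (KC x)

lemma TC_d (x : Fin 3 → R) (n : ℕ) : (TC k x).d (n + 1) n =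
    ((tensoringLeft (ModuleCat.{0} R)).obj (ModuleCat.of R k)).map (Kd x n) := by
  rw [← KC_d]; rfl

lemma TC_zero (x : Fin 3 → R) (n : ℕ) : IsZero ((TC k x).X (n + 4)) := by
  have : Subsingleton ((TC k x).X (n + 4)) := (te (R := R) k Empty).injective.subsingleton
  exact ModuleCat.isZero_of_subsingleton _

lemma TC_h4 (x : Fin 3 → R) (n : ℕ) : IsZero ((TC k x).homology (n + 4)) :=
  ShortComplex.isZero_homology_of_isZero_X₂ _ (TC_zero x n)

lemma dim_sc (x : Fin 3 → R) (i j l : ℕ) (hi : (ComplexShape.down ℕ).prev j = i)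
    (hl : (ComplexShape.down ℕ).next j = l) :
    Module.finrank k ((ModuleCat.restrictScalars a).obj ((TC k x).homology j)) =
    Module.finrank k ((ModuleCat.restrictScalars a).obj ((TC k x).sc' i j l).homology) :=
  ((ModuleCat.restrictScalars a).mapIso
    (ShortComplex.homologyMapIso ((TC k x).isoSc' i j l hi hl))).toLinearEquiv.finrank_eq

def E0 (x : Fin 3 → R) : (TC k x).X 0 ≃ₗ[R] (Fin 12 → k) := te k (Fin 12)
def E1 (x : Fin 3 → R) : (TC k x).X 1 ≃ₗ[R] (Fin 3 × Fin 12 → k) := te k (Fin 3 × Fin 12)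
def E2 (x : Fin 3 → R) : (TC k x).X 2 ≃ₗ[R] (Fin 3 × Fin 12 → k) := te k (Fin 3 × Fin 12)
def E3 (x : Fin 3 → R) : (TC k x).X 3 ≃ₗ[R] (Fin 12 → k) := te k (Fin 12)
def E4 (x : Fin 3 → R) : (TC k x).X 4 ≃ₗ[R] (Empty → k) := te k Empty

lemma dE1 (hg : ∀ (r : R) (c : k), r • c = g r * c) (x : Fin 3 → R) (v : (TC k x).X 1) :
    E0 x ((TC k x).d 1 0 v) = (D1 (fun i => g (x i))).mulVec (E1 x v) := by
  rw [TC_d x 0, ← D1_map]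
  exact te_mv g hg (D1 x) v

lemma dE2 (hg : ∀ (r : R) (c : k), r • c = g r * c) (x : Fin 3 → R) (v : (TC k x).X 2) :
    E1 x ((TC k x).d 2 1 v) = (D2 (fun i => g (x i))).mulVec (E2 x v) := by
  rw [TC_d x 1, ← D2_map]
  exact te_mv g hg (D2 x) v

lemma dE3 (hg : ∀ (r : R) (c : k), r • c = g r * c) (x : Fin 3 → R) (v : (TC k x).X 3) :
    E2 x ((TC k x).d 3 2 v) = (D3 (fun i => g (x i))).mulVec (E3 x v) := by
  rw [TC_d x 2, ← D3_map]
  exact te_mv g hg (D3 x) v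

lemma dE0 (x : Fin 3 → R) (v : (TC k x).X 0) :
    E0 x ((TC k x).d 0 0 v) = (0 : Matrix (Fin 12) (Fin 12) k).mulVec (E0 x v) := by
  rw [Matrix.zero_mulVec, (TC k x).shape 0 0 (by simp)]
  exact map_zero (E0 x)

lemma dE4 (x : Fin 3 → R) (v : (TC k x).X 4) :
    E3 x ((TC k x).d 4 3 v) = (0 : Matrix (Fin 12) Empty k).mulVec (E4 x v) := by
  have : v = 0 := (E4 x).injective (Subsingleton.elim _ _)
  rw [Matrix.zero_mulVec, this, map_zero, map_zero]


lemma dim0 (hg : ∀ (r : R) (c : k), r • c = g r * c) (ha : ∀ c, g (a c) = c)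
    (x : Fin 3 → R) :
    Module.finrank k ((ModuleCat.restrictScalars a).obj ((TC k x).homology 0)) +
      (D1 (fun i => g (x i))).rank = 12 := by
  rw [dim_sc a x 1 0 0 (by simp) (by simp)]
  have := frS g a hg ha ((TC k x).sc' 1 0 0) (D1 (fun i => g (x i)))
    (0 : Matrix (Fin 12) (Fin 12) k) (E1 x) (E0 x) (E0 x) (dE1 g hg x) (dE0 x)
  rw [Matrix.rank_zero] at this
  simpa using this

lemma dim1 (hg : ∀ (r : R) (c : k), r • c = g r * c) (ha : ∀ c, g (a c) = c)
    (x : Fin 3 → R) :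
    Module.finrank k ((ModuleCat.restrictScalars a).obj ((TC k x).homology 1)) +
      (D2 (fun i => g (x i))).rank + (D1 (fun i => g (x i))).rank = 36 := by
  rw [dim_sc a x 2 1 0 (by simp) (by simp)]
  have := frS g a hg ha ((TC k x).sc' 2 1 0) (D2 (fun i => g (x i)))
    (D1 (fun i => g (x i))) (E2 x) (E1 x) (E0 x) (dE2 g hg x) (dE1 g hg x)
  simpa using this

lemma dim2 (hg : ∀ (r : R) (c : k), r • c = g r * c) (ha : ∀ c, g (a c) = c)
    (x : Fin 3 → R) :
    Module.finrank k ((ModuleCat.restrictScalars a).obj ((TC k x).homology 2)) +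
      (D3 (fun i => g (x i))).rank + (D2 (fun i => g (x i))).rank = 36 := by
  rw [dim_sc a x 3 2 1 (by simp) (by simp)]
  have := frS g a hg ha ((TC k x).sc' 3 2 1) (D3 (fun i => g (x i)))
    (D2 (fun i => g (x i))) (E3 x) (E2 x) (E1 x) (dE3 g hg x) (dE2 g hg x)
  simpa using this

lemma dim3 (hg : ∀ (r : R) (c : k), r • c = g r * c) (ha : ∀ c, g (a c) = c)
    (x : Fin 3 → R) :
    Module.finrank k ((ModuleCat.restrictScalars a).obj ((TC k x).homology 3)) +
      (D3 (fun i => g (x i))).rank = 12 := by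
  rw [dim_sc a x 4 3 2 (by simp) (by simp)]
  have := frS g a hg ha ((TC k x).sc' 4 3 2) (0 : Matrix (Fin 12) Empty k)
    (D3 (fun i => g (x i))) (E4 x) (E3 x) (E2 x) (dE4 x) (dE3 g hg x)
  rw [Matrix.rank_zero] at this
  simpa using this

end Hom

def xA : Fin 3 → A := fun k => X k

def torIso (n : ℕ) : ((Tor (ModuleCat A) n).obj (ModuleCat.of A ℚ)).obj M19 ≅
    (TC ℚ xA).homology n :=
  PM.isoLeftDerivedObj ((tensoringLeft (ModuleCat.{0} A)).obj (ModuleCat.of A ℚ)) n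

lemma dimTor (n : ℕ) : Module.finrank ℚ (TorQ n M19) = Module.finrank ℚ
    ((ModuleCat.restrictScalars (algebraMap ℚ A)).obj ((TC ℚ xA).homology n)) :=
  ((ModuleCat.restrictScalars (algebraMap ℚ A)).mapIso (torIso n)).toLinearEquiv.finrank_eq

def gA : A →+* ℚ := (MvPolynomial.aeval (fun _ : Fin 3 => (0 : ℚ))).toRingHom

lemma hgA (r : A) (c : ℚ) : r • c = gA r * c := rfl
lemma haA (c : ℚ) : gA (algebraMap ℚ A c) = c := by
  simp [gA]
lemma gx : (fun i => gA (xA i)) = fun _ => (0 : ℚ) := by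
  ext i
  simp [gA, xA]

end S19

/-- Each of `ρ₁, ρ₂, ρ₃` spans a trivial `A`-submodule of `𝔏'` (the variables act by zero),
and `Tor_j^A(ℚ, 𝔏'/𝔎')` has `ℚ`-dimension `4, 15, 17, 6` for `j = 0, 1, 2, 3` and vanishes
for `j ≥ 4`. -/
theorem statement19 :
    (∀ i : Fin 3, (X i : A) • ρ₁ = 0 ∧ (X i : A) • ρ₂ = 0 ∧ (X i : A) • ρ₃ = 0) ∧
    Module.finrank ℚ (TorQ 0 M19) = 4 ∧
    Module.finrank ℚ (TorQ 1 M19) = 15 ∧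
    Module.finrank ℚ (TorQ 2 M19) = 17 ∧
    Module.finrank ℚ (TorQ 3 M19) = 6 ∧
    ∀ j : ℕ, 4 ≤ j → Subsingleton (TorQ j M19) := by
  have h0 := S19.dim0 S19.gA (algebraMap ℚ A) S19.hgA S19.haA S19.xA
  have h1 := S19.dim1 S19.gA (algebraMap ℚ A) S19.hgA S19.haA S19.xA
  have h2 := S19.dim2 S19.gA (algebraMap ℚ A) S19.hgA S19.haA S19.xA
  have h3 := S19.dim3 S19.gA (algebraMap ℚ A) S19.hgA S19.haA S19.xA
  rw [S19.gx, S19.rank1, ← S19.dimTor] at h0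
  rw [S19.gx, S19.rank2, S19.rank1, ← S19.dimTor] at h1
  rw [S19.gx, S19.rank3, S19.rank2, ← S19.dimTor] at h2
  rw [S19.gx, S19.rank3, ← S19.dimTor] at h3
  refine ⟨fun i => ⟨S19.triv1 i, S19.triv2 i, S19.triv3 i⟩, by omega, by omega, by omega,
    by omega, ?_⟩
  intro j hj
  obtain ⟨n, rfl⟩ := Nat.exists_eq_add_of_le' hj
  have hs : Subsingleton (((Tor (ModuleCat A) (n + 4)).obj (ModuleCat.of A ℚ)).obj M19) :=
    ModuleCat.subsingleton_of_isZero
      ((S19.TC_h4 (k := ℚ) S19.xA n).of_iso (S19.torIso (n + 4)))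
  exact hs

end
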